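/- Suppose x_3 = x_4 = ⋯ = x_n, ρ ≥ 0, and the hypotheses (i) x_1 ≤ x_2 ≤ min_{3≤i≤n} x_i, (ii) S + m·M_{12} ≥ −ρ, (iii) S + (m+1)·M_{12} < −(m+1)(m+n−1)·ρ hold. Then the following six inequalities hold: (1) M_{12} < −ρ ≤ 0; (2) M_{33} > 0; (3) M_{12} + ((n−1)/2)·M_{33} > 0; (4) (m+n−1)·(−M_{12}) ≥ ((n−1)(n−2)/2)·M_{33}; (5) ((n−1)(n−2)/2)·M_{33} ≥ −ρ − (m+n−2)·M_{12}; (6) (n−2)·( M_{12} + ((n−1)/2)·M_{33} ) ≥ (m−1)·(−M_{12}). -/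

import Mathlib

open Finset

/-- `M x i j = x_i + x_j`. -/
noncomputable def solM (x : ℕ → ℝ) (i j : ℕ) : ℝ := x i + x j

/-- `S = Σ_{i<j, {i,j}≠{1,2}} M_{ij}`, indices running over `1,…,n`. -/
noncomputable def solS (n : ℕ) (x : ℕ → ℝ) : ℝ :=
  ∑ i ∈ Icc 1 n, ∑ j ∈ Icc 1 n,
    if i < j ∧ ¬(i = 1 ∧ j = 2) then solM x i j else 0

/-- The function `f` from the algebra lemma. -/
noncomputable def solf (n m : ℕ) (x : ℕ → ℝ) : ℝ :=
  -(solS n x / ((m : ℝ) + 1)) * (solS n x + ((m : ℝ) + 1) * solM x 1 2)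
    - solM x 1 2 * solS n x
    + ((∑ i ∈ Icc 1 n, ∑ j ∈ Icc 1 n,
        if i < j ∧ ¬(i = 1 ∧ j = 2) then
          (solM x i j) ^ 2 +
            ∑ k ∈ (Icc 1 n).filter (fun k => k ≠ i ∧ k ≠ j), solM x i k * solM x j k
        else 0)
      + ((m : ℝ) + 1) *
          ∑ k ∈ (Icc 1 n).filter (fun k => k ≠ 1 ∧ k ≠ 2), solM x 1 k * solM x 2 k)

/-- The sum of `x_i + x_j` over the pairs `i < j` other than `{1,2}`: each `x_i` occurs in `n - 1`
of the pairs. -/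
lemma solS_eq (n : ℕ) (hn : 2 ≤ n) (x : ℕ → ℝ) :
    solS n x = ((n : ℝ) - 1) * ∑ i ∈ Icc 1 n, x i - solM x 1 2 := by
  induction n, hn using Nat.le_induction with
  | base => norm_num [solS, solM, sum_Icc_succ_top]
  | succ n hn ih =>
    have hstep : solS (n + 1) x = solS n x + ∑ i ∈ Icc 1 n, (x i + x (n + 1)) := by
      have hlast : ∑ j ∈ Icc 1 (n + 1),
          (if n + 1 < j ∧ ¬(n + 1 = 1 ∧ j = 2) then solM x (n + 1) j else 0) = 0 := by
        refine sum_eq_zero fun j hj => if_neg fun h => ?_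
        have := (mem_Icc.mp hj).2
        omega
      unfold solS
      rw [sum_Icc_succ_top (by omega), hlast, add_zero, ← sum_add_distrib]
      refine sum_congr rfl fun i hi => ?_
      have := (mem_Icc.mp hi).2
      rw [sum_Icc_succ_top (by omega), if_pos (by omega), solM]
    rw [hstep, ih, sum_Icc_succ_top (by omega), sum_add_distrib, sum_const, Nat.card_Icc]
    simp only [Nat.add_sub_cancel, nsmul_eq_mul]
    push_cast
    ring

lemma sum_Icc_eq_of_const_from_three (n : ℕ) (hn : 2 ≤ n) (x : ℕ → ℝ)
    (hx : ∀ i, 3 ≤ i → i ≤ n → x i = x 3) :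
    ∑ i ∈ Icc 1 n, x i = x 1 + x 2 + ((n : ℝ) - 2) * x 3 := by
  induction n, hn using Nat.le_induction with
  | base => norm_num [sum_Icc_succ_top]
  | succ n hn ih =>
    rw [sum_Icc_succ_top (by omega), ih fun i h3 hi => hx i h3 (by omega),
      hx (n + 1) (by omega) le_rfl]
    push_cast
    ring

/-- The six inequalities of the Claim in the proof of the algebra lemma. -/
theorem six_inequalities (n m : ℕ) (hn : 4 ≤ n) (hm : 1 ≤ m) (ρ : ℝ) (hρ : 0 ≤ ρ)
    (x : ℕ → ℝ)
    (hx : ∀ i, 3 ≤ i → i ≤ n → x i = x 3)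
    (h1 : x 1 ≤ x 2 ∧ ∀ i, 3 ≤ i → i ≤ n → x 2 ≤ x i)
    (h2 : solS n x + (m : ℝ) * solM x 1 2 ≥ -ρ)
    (h3 : solS n x + ((m : ℝ) + 1) * solM x 1 2 <
      -(((m : ℝ) + 1) * ((m : ℝ) + (n : ℝ) - 1)) * ρ) :
    (solM x 1 2 < -ρ ∧ -ρ ≤ 0) ∧
    solM x 3 3 > 0 ∧
    solM x 1 2 + ((n : ℝ) - 1) / 2 * solM x 3 3 > 0 ∧
    ((m : ℝ) + (n : ℝ) - 1) * (-(solM x 1 2)) ≥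
      ((n : ℝ) - 1) * ((n : ℝ) - 2) / 2 * solM x 3 3 ∧
    ((n : ℝ) - 1) * ((n : ℝ) - 2) / 2 * solM x 3 3 ≥
      -ρ - ((m : ℝ) + (n : ℝ) - 2) * solM x 1 2 ∧
    ((n : ℝ) - 2) * (solM x 1 2 + ((n : ℝ) - 1) / 2 * solM x 3 3) ≥
      ((m : ℝ) - 1) * (-(solM x 1 2)) := by
  have hS : solS n x = ((n : ℝ) - 2) * solM x 1 2
      + ((n : ℝ) - 1) * ((n : ℝ) - 2) / 2 * solM x 3 3 := by
    rw [solS_eq n (by omega), sum_Icc_eq_of_const_from_three n (by omega) x hx]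
    simp only [solM]
    ring
  rw [hS] at h2 h3
  have hn' : (4 : ℝ) ≤ n := by exact_mod_cast hn
  have hm' : (1 : ℝ) ≤ m := by exact_mod_cast hm
  generalize solM x 1 2 = P at *
  generalize solM x 3 3 = Q at *
  have hcoef : 2 * ρ ≤ ((m : ℝ) + 1) * ((m : ℝ) + (n : ℝ) - 1) * ρ :=
    mul_le_mul_of_nonneg_right (by nlinarith) hρ
  have hP : P < -ρ := by linarith
  have hsum : 0 < ((n : ℝ) - 2) * (P + ((n : ℝ) - 1) / 2 * Q) - ((m : ℝ) - 1) * (-P) := by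
    linarith
  have hpos : 0 < P + ((n : ℝ) - 1) / 2 * Q := by
    have : 0 ≤ ((m : ℝ) - 1) * (-P) := mul_nonneg (by linarith) (by linarith)
    exact pos_of_mul_pos_right (by linarith) (by linarith : (0 : ℝ) ≤ (n : ℝ) - 2)
  have hQ : 0 < Q :=
    pos_of_mul_pos_right (by linarith) (by linarith : (0 : ℝ) ≤ ((n : ℝ) - 1) / 2)
  exact ⟨⟨hP, by linarith⟩, hQ, hpos, by linarith, by linarith, by linarith⟩
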